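/- Refined Ricci formula for solutions of the weighted Monge–Ampère equation: if u solves the weighted Monge–Ampère equation, then at every point of N one has Ric_{ij} = (1/4) g^{pq} g^{mn} u_{,ipm} u_{,jqn} − (1/4)(u_{,ijp} ξ^p − g^{pq} u_{,ijp} v_q). -/

import Mathlib

open scoped BigOperators
noncomputable section

namespace KRS

variable {n : ℕ}

/-- Partial derivative of `f` in the `i`-th coordinate direction. -/
def pd (i : Fin n) (f : (Fin n → ℝ) → ℝ) : (Fin n → ℝ) → ℝ :=
  fun x => fderiv ℝ f x (Pi.single i 1)

/-- The Hessian matrix `g(x)` of `u`, with entries `g_{ij} = ∂²u/∂x^i∂x^j`. -/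
def hessian (u : (Fin n → ℝ) → ℝ) (x : Fin n → ℝ) : Matrix (Fin n) (Fin n) ℝ :=
  Matrix.of fun i j => pd i (pd j u) x

/-- The inverse matrix `g(x)⁻¹`, with entries `g^{ij}`. -/
def ginv (u : (Fin n → ℝ) → ℝ) (x : Fin n → ℝ) : Matrix (Fin n) (Fin n) ℝ :=
  (hessian u x)⁻¹

/-- Third iterated partial derivative `u_{,ijk}`. -/
def d3 (u : (Fin n → ℝ) → ℝ) (i j k : Fin n) : (Fin n → ℝ) → ℝ :=
  pd i (pd j (pd k u))

/-- Fourth iterated partial derivative `u_{,ijkl}`. -/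
def d4 (u : (Fin n → ℝ) → ℝ) (i j k l : Fin n) : (Fin n → ℝ) → ℝ :=
  pd i (pd j (pd k (pd l u)))

/-- Christoffel symbols `Γ^k_{ij} = (1/2) g^{kl}(∂_i g_{jl} + ∂_j g_{il} − ∂_l g_{ij})`. -/
def Christoffel (u : (Fin n → ℝ) → ℝ) (k i j : Fin n) : (Fin n → ℝ) → ℝ :=
  fun x => (1/2) * ∑ l, ginv u x k l * (d3 u i j l x + d3 u j i l x - d3 u l i j x)

/-- Riemann curvature tensor
`Rm_{ijkl} = g_{is}(∂_k Γ^s_{lj} − ∂_l Γ^s_{kj} + Γ^s_{kp} Γ^p_{lj} − Γ^s_{lp} Γ^p_{kj})`. -/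
def Rm (u : (Fin n → ℝ) → ℝ) (i j k l : Fin n) : (Fin n → ℝ) → ℝ :=
  fun x => ∑ s, hessian u x i s *
    (pd k (Christoffel u s l j) x - pd l (Christoffel u s k j) x
      + ∑ p, Christoffel u s k p x * Christoffel u p l j x
      - ∑ p, Christoffel u s l p x * Christoffel u p k j x)

/-- Ricci tensor `Ric_{ij} = ∂_k Γ^k_{ij} − ∂_j Γ^k_{ik} + Γ^k_{kp} Γ^p_{ij} − Γ^k_{jp} Γ^p_{ik}`. -/
def Ricci (u : (Fin n → ℝ) → ℝ) (i j : Fin n) : (Fin n → ℝ) → ℝ :=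
  fun x => (∑ k, pd k (Christoffel u k i j) x) - (∑ k, pd j (Christoffel u k i k) x)
    + (∑ k, ∑ p, Christoffel u k k p x * Christoffel u p i j x)
    - (∑ k, ∑ p, Christoffel u k j p x * Christoffel u p i k x)

/-- Scalar curvature `s = g^{ij} Ric_{ij}`. -/
def scalarCurv (u : (Fin n → ℝ) → ℝ) : (Fin n → ℝ) → ℝ :=
  fun x => ∑ i, ∑ j, ginv u x i j * Ricci u i j x

/-- Covariant Hessian `(∇²φ)_{ij} = φ_{,ij} − Γ^k_{ij} φ_{,k}`. -/
def covHess (u φ : (Fin n → ℝ) → ℝ) (i j : Fin n) : (Fin n → ℝ) → ℝ :=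
  fun x => pd i (pd j φ) x - ∑ k, Christoffel u k i j x * pd k φ x

/-- Laplace–Beltrami operator `Δφ = g^{ij} (∇²φ)_{ij}`. -/
def laplacian (u φ : (Fin n → ℝ) → ℝ) : (Fin n → ℝ) → ℝ :=
  fun x => ∑ i, ∑ j, ginv u x i j * covHess u φ i j x

/-- Weighted (drift) Laplacian `Δ_φ F = ΔF − g^{ij} φ_{,i} F_{,j}`. -/
def driftLap (u φ F : (Fin n → ℝ) → ℝ) : (Fin n → ℝ) → ℝ :=
  fun x => laplacian u F x - ∑ i, ∑ j, ginv u x i j * pd i φ x * pd j F x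

/-- Bakry–Émery Ricci tensor `(Ric_φ)_{ij} = Ric_{ij} + (∇²φ)_{ij}`. -/
def ricciPhi (u φ : (Fin n → ℝ) → ℝ) (i j : Fin n) : (Fin n → ℝ) → ℝ :=
  fun x => Ricci u i j x + covHess u φ i j x

/-- Pointwise squared `g`-norm of the third derivative tensor:
`|u_{,ijk}|²_g = g^{ip} g^{jq} g^{kr} u_{,ijk} u_{,pqr}`. -/
def norm3 (u : (Fin n → ℝ) → ℝ) : (Fin n → ℝ) → ℝ :=
  fun x => ∑ i, ∑ j, ∑ k, ∑ p, ∑ q, ∑ r,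
    ginv u x i p * ginv u x j q * ginv u x k r * d3 u i j k x * d3 u p q r x

/-- The canonical weight function `φ = (1/2)(u_{,p} ξ^p + v_q x^q)`. -/
def weight (u : (Fin n → ℝ) → ℝ) (ξ v : Fin n → ℝ) : (Fin n → ℝ) → ℝ :=
  fun x => (1/2) * ((∑ p, pd p u x * ξ p) + ∑ q, v q * x q)

/-- `u` solves the weighted Monge–Ampère equation
`log det g(x) = −v_p x^p + u_{,q}(x) ξ^q + c` on `N`. -/
def MAeq (u : (Fin n → ℝ) → ℝ) (N : Set (Fin n → ℝ)) (v ξ : Fin n → ℝ) (c : ℝ) : Prop :=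
  ∀ x ∈ N, Real.log (hessian u x).det = -(∑ p, v p * x p) + (∑ q, pd q u x * ξ q) + c

/-- Covariant derivative of the third derivative tensor:
`(∇T)_{lijk} = u_{,ijkl} − Γ^s_{li} u_{,sjk} − Γ^s_{lj} u_{,isk} − Γ^s_{lk} u_{,ijs}`. -/
def covT (u : (Fin n → ℝ) → ℝ) (l i j k : Fin n) : (Fin n → ℝ) → ℝ :=
  fun x => d4 u i j k l x - (∑ s, Christoffel u s l i x * d3 u s j k x)
    - (∑ s, Christoffel u s l j x * d3 u i s k x)
    - (∑ s, Christoffel u s l k x * d3 u i j s x)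

/-- Completeness of the Hessian metric `g = D²u` on `N`: every C¹ curve
`γ : [0,1) → N` that eventually leaves every compact subset of `N`
has infinite `g`-length. -/
def HessComplete (u : (Fin n → ℝ) → ℝ) (N : Set (Fin n → ℝ)) : Prop :=
  ∀ γ : ℝ → (Fin n → ℝ),
    ContDiffOn ℝ 1 γ (Set.Ico (0:ℝ) 1) →
    (∀ t ∈ Set.Ico (0:ℝ) 1, γ t ∈ N) →
    (∀ K : Set (Fin n → ℝ), IsCompact K → K ⊆ N →
      ∃ tK ∈ Set.Ico (0:ℝ) 1, ∀ t ∈ Set.Ioo tK 1, γ t ∉ K) →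
    ∫⁻ t in Set.Ioo (0:ℝ) 1,
      ENNReal.ofReal (Real.sqrt (∑ i, ∑ j,
        hessian u (γ t) i j * deriv γ t i * deriv γ t j)) = ⊤


section Calculus

variable {N : Set (Fin n → ℝ)} {f h : (Fin n → ℝ) → ℝ} {x : Fin n → ℝ}

lemma pd_congr (hN : IsOpen N) (hfh : Set.EqOn f h N) (hx : x ∈ N) (i : Fin n) :
    pd i f x = pd i h x := by
  simp only [pd, (hfh.eventuallyEq_of_mem (hN.mem_nhds hx)).fderiv_eq]

lemma _root_.ContDiffOn.pd (hN : IsOpen N) (hf : ContDiffOn ℝ (⊤ : ℕ∞) f N) (i : Fin n) :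
    ContDiffOn ℝ (⊤ : ℕ∞) (pd i f) N :=
  (hf.fderiv_of_isOpen hN (by simp)).clm_apply contDiffOn_const

lemma _root_.ContDiffOn.differentiableAt_of_isOpen (hN : IsOpen N)
    (hf : ContDiffOn ℝ (⊤ : ℕ∞) f N) (hx : x ∈ N) : DifferentiableAt ℝ f x :=
  (hf.contDiffAt (hN.mem_nhds hx)).differentiableAt (by simp)

lemma pd_comm (hN : IsOpen N) (hf : ContDiffOn ℝ (⊤ : ℕ∞) f N) (hx : x ∈ N) (i j : Fin n) :
    pd i (pd j f) x = pd j (pd i f) x := by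
  have hd : DifferentiableAt ℝ (fderiv ℝ f) x :=
    ((hf.fderiv_of_isOpen (m := (⊤ : ℕ∞)) hN (by simp)).contDiffAt
      (hN.mem_nhds hx)).differentiableAt (by simp)
  have key : ∀ a b : Fin n, pd a (pd b f) x
      = fderiv ℝ (fderiv ℝ f) x (Pi.single a 1) (Pi.single b 1) := by
    intro a b
    change fderiv ℝ (fun y => fderiv ℝ f y (Pi.single b 1)) x (Pi.single a 1) = _
    rw [fderiv_clm_apply hd (differentiableAt_const _)]
    simp
  rw [key, key]
  exact (hf.contDiffAt (hN.mem_nhds hx)).isSymmSndFDerivAt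
    (by simpa using WithTop.coe_le_coe.2 (le_top : (2 : ℕ∞) ≤ ⊤)) _ _

lemma pd_mul (hf : DifferentiableAt ℝ f x) (hh : DifferentiableAt ℝ h x) (i : Fin n) :
    pd i (fun y => f y * h y) x = pd i f x * h x + f x * pd i h x := by
  simp only [pd]
  rw [fderiv_fun_mul hf hh]
  simp only [_root_.add_apply, _root_.smul_apply, smul_eq_mul]
  ring

lemma pd_sum {F : Fin n → (Fin n → ℝ) → ℝ} (hF : ∀ l, DifferentiableAt ℝ (F l) x) (i : Fin n) :
    pd i (fun y => ∑ l, F l y) x = ∑ l, pd i (F l) x := by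
  simp only [pd]
  rw [fderiv_fun_sum fun l _ => hF l]
  simp

lemma pd_const (a : ℝ) (i : Fin n) : pd i (fun _ => a) x = 0 := by
  simp [pd]

lemma pd_coord (i j : Fin n) : pd i (fun y => y j) x = (1 : Matrix (Fin n) (Fin n) ℝ) i j := by
  have h : HasFDerivAt (fun y : Fin n → ℝ => y j) (ContinuousLinearMap.proj j) x :=
    (ContinuousLinearMap.proj (R := ℝ) (φ := fun _ : Fin n => ℝ) j).hasFDerivAt
  simp only [pd, h.fderiv, ContinuousLinearMap.proj_apply, Matrix.one_apply, Pi.single_apply,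
    eq_comm]

lemma pd_sum_mul {A B : Fin n → (Fin n → ℝ) → ℝ} (hA : ∀ l, DifferentiableAt ℝ (A l) x)
    (hB : ∀ l, DifferentiableAt ℝ (B l) x) (i : Fin n) :
    pd i (fun y => ∑ l, A l y * B l y) x = ∑ l, (pd i (A l) x * B l x + A l x * pd i (B l) x) := by
  rw [pd_sum fun l => (hA l).fun_mul (hB l)]
  exact Finset.sum_congr rfl fun l _ => pd_mul (hA l) (hB l) i

end Calculus

section MatrixCalculus

variable {N : Set (Fin n → ℝ)} {A : (Fin n → ℝ) → Matrix (Fin n) (Fin n) ℝ} {x : Fin n → ℝ}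

lemma _root_.ContDiffOn.matrix_det (hA : ∀ a b, ContDiffOn ℝ (⊤ : ℕ∞) (fun y => A y a b) N) :
    ContDiffOn ℝ (⊤ : ℕ∞) (fun y => (A y).det) N := by
  simp only [Matrix.det_apply]
  exact ContDiffOn.sum fun σ _ => (contDiffOn_prod fun i _ => hA _ _).const_smul _

lemma _root_.ContDiffOn.matrix_inv (hA : ∀ a b, ContDiffOn ℝ (⊤ : ℕ∞) (fun y => A y a b) N)
    (hdet : ∀ y ∈ N, (A y).det ≠ 0) (a b : Fin n) :
    ContDiffOn ℝ (⊤ : ℕ∞) (fun y => (A y)⁻¹ a b) N := by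
  simp only [Matrix.inv_def, Matrix.smul_apply, Ring.inverse_eq_inv', smul_eq_mul,
    Matrix.adjugate_apply]
  refine (ContDiffOn.matrix_det hA).inv hdet |>.mul (ContDiffOn.matrix_det fun c d => ?_)
  simp only [Matrix.updateRow_apply]
  split_ifs
  · exact contDiffOn_const
  · exact hA c d

/-- Jacobi formula for the derivative of a determinant. -/
lemma pd_det (hA : ∀ a b, DifferentiableAt ℝ (fun y => A y a b) x) (i : Fin n) :
    pd i (fun y => (A y).det) x
      = ∑ a, ∑ b, (A x).adjugate b a * pd i (fun y => A y a b) x := by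
  let D : ContinuousMultilinearMap ℝ (fun _ : Fin n => Fin n → ℝ) ℝ :=
    { toMultilinearMap := (Matrix.detRowAlternating (n := Fin n) (R := ℝ)).toMultilinearMap
      cont := Continuous.matrix_det continuous_id }
  let A' : (Fin n → ℝ) → Fin n → Fin n → ℝ := A
  have hA' : HasFDerivAt A' (ContinuousLinearMap.pi fun a => ContinuousLinearMap.pi fun b =>
      fderiv ℝ (fun y => A y a b) x) x :=
    hasFDerivAt_pi.2 fun a => hasFDerivAt_pi.2 fun b => (hA a b).hasFDerivAt
  have hD := (D.hasFDerivAt (A' x)).comp x hA'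
  change fderiv ℝ (D ∘ A') x (Pi.single i 1) = _
  rw [hD.fderiv, ContinuousLinearMap.comp_apply, ContinuousMultilinearMap.linearDeriv_apply]
  refine Finset.sum_congr rfl fun a _ => ?_
  change ((A x).updateRow a fun b => pd i (fun y => A y a b) x).det = _
  rw [← Matrix.cramer_transpose_apply, Matrix.cramer_eq_adjugate_mulVec,
    ← Matrix.adjugate_transpose]
  rfl

lemma pd_log_det (hA : ∀ a b, DifferentiableAt ℝ (fun y => A y a b) x) (hdet : (A x).det ≠ 0)
    (i : Fin n) :
    pd i (fun y => Real.log (A y).det) x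
      = ∑ a, ∑ b, (A x)⁻¹ b a * pd i (fun y => A y a b) x := by
  have hd : DifferentiableAt ℝ (fun y => (A y).det) x := by
    simp only [Matrix.det_apply]
    fun_prop
  have h : pd i (fun y => Real.log (A y).det) x = (A x).det⁻¹ * pd i (fun y => (A y).det) x := by
    simp only [pd, fderiv.log hd hdet, _root_.smul_apply, smul_eq_mul]
  rw [h, pd_det hA]
  simp only [Matrix.inv_def, Matrix.smul_apply, Ring.inverse_eq_inv', smul_eq_mul,
    Finset.mul_sum, mul_assoc]

lemma pd_inv (hN : IsOpen N) (hx : x ∈ N)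
    (hA : ∀ a b, ContDiffOn ℝ (⊤ : ℕ∞) (fun y => A y a b) N)
    (hdet : ∀ y ∈ N, (A y).det ≠ 0) (i a b : Fin n) :
    pd i (fun y => (A y)⁻¹ a b) x
      = -∑ c, ∑ d, (A x)⁻¹ a c * pd i (fun y => A y c d) x * (A x)⁻¹ d b := by
  have hu : IsUnit (A x).det := (hdet x hx).isUnit
  let P : Matrix (Fin n) (Fin n) ℝ := Matrix.of fun a b => pd i (fun y => (A y)⁻¹ a b) x
  let Q : Matrix (Fin n) (Fin n) ℝ := Matrix.of fun a b => pd i (fun y => A y a b) x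
  have h : P * A x + (A x)⁻¹ * Q = 0 := by
    ext a b
    have h1 : pd i (fun y => ∑ l, (A y)⁻¹ a l * A y l b) x
        = pd i (fun _ => (1 : Matrix (Fin n) (Fin n) ℝ) a b) x := by
      refine pd_congr hN (fun y hy => ?_) hx i
      rw [← Matrix.nonsing_inv_mul (A y) (hdet y hy).isUnit]
      rfl
    rw [pd_const, pd_sum_mul
      (fun l => (ContDiffOn.matrix_inv hA hdet a l).differentiableAt_of_isOpen hN hx)
      (fun l => (hA l b).differentiableAt_of_isOpen hN hx), Finset.sum_add_distrib] at h1
    exact h1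
  have hP : P = -((A x)⁻¹ * Q * (A x)⁻¹) := by
    calc P = P * A x * (A x)⁻¹ := (Matrix.mul_nonsing_inv_cancel_right _ _ hu).symm
      _ = _ := by rw [eq_neg_of_add_eq_zero_left h, Matrix.neg_mul]
  have := congrFun (congrFun hP a) b
  simp only [Matrix.neg_apply, Matrix.mul_apply, Finset.sum_mul] at this
  rw [Finset.sum_comm]
  exact this

end MatrixCalculus

section Hessian

variable {N : Set (Fin n → ℝ)} {u : (Fin n → ℝ) → ℝ} {x : Fin n → ℝ}

lemma d3_swap_left (hN : IsOpen N) (hu : ContDiffOn ℝ (⊤ : ℕ∞) u N) (hx : x ∈ N)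
    (i j k : Fin n) : d3 u i j k x = d3 u j i k x :=
  pd_comm hN (hu.pd hN k) hx i j

lemma d3_swap_right (hN : IsOpen N) (hu : ContDiffOn ℝ (⊤ : ℕ∞) u N) (hx : x ∈ N)
    (i j k : Fin n) : d3 u i j k x = d3 u i k j x :=
  pd_congr hN (fun _ hy => pd_comm hN hu hy j k) hx i

lemma christoffel_eq (hN : IsOpen N) (hu : ContDiffOn ℝ (⊤ : ℕ∞) u N) (hx : x ∈ N)
    (k i j : Fin n) : Christoffel u k i j x = ∑ l, (1 / 2 * ginv u x k l) * d3 u i j l x := by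
  simp only [Christoffel, Finset.mul_sum]
  refine Finset.sum_congr rfl fun l _ => ?_
  rw [d3_swap_left hN hu hx j i l, d3_swap_left hN hu hx l i j, d3_swap_right hN hu hx i l j]
  ring

lemma pd_christoffel (hN : IsOpen N) (hu : ContDiffOn ℝ (⊤ : ℕ∞) u N)
    (hdet : ∀ y ∈ N, (hessian u y).det ≠ 0) (hx : x ∈ N) (m k i j : Fin n) :
    pd m (Christoffel u k i j) x
      = ∑ l, (1 / 2 * pd m (fun y => ginv u y k l) x * d3 u i j l x
          + 1 / 2 * ginv u x k l * d4 u m i j l x) := by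
  have hH : ∀ a b, ContDiffOn ℝ (⊤ : ℕ∞) (fun y => hessian u y a b) N :=
    fun a b => (hu.pd hN b).pd hN a
  have hG : ∀ l, DifferentiableAt ℝ (fun y => ginv u y k l) x :=
    fun l => (ContDiffOn.matrix_inv hH hdet k l).differentiableAt_of_isOpen hN hx
  rw [pd_congr hN (fun y hy => christoffel_eq hN hu hy k i j) hx m,
    pd_sum_mul (B := fun l => d3 u i j l) (fun l => (hG l).const_mul _)
      (fun l => (((hu.pd hN l).pd hN j).pd hN i).differentiableAt_of_isOpen hN hx)]
  refine Finset.sum_congr rfl fun l _ => ?_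
  rw [pd_mul (differentiableAt_const _) (hG l), pd_const, zero_mul, zero_add]
  rfl

/-- The Ricci tensor of a Hessian metric in terms of its third derivatives: the fourth
derivatives cancel. -/
lemma ricci_eq (hN : IsOpen N) (hu : ContDiffOn ℝ (⊤ : ℕ∞) u N)
    (hdet : ∀ y ∈ N, (hessian u y).det ≠ 0) (hx : x ∈ N) (i j : Fin n) :
    Ricci u i j x =
      1 / 2 * (∑ k, ∑ l, pd k (fun y => ginv u y k l) x * d3 u i j l x)
      - 1 / 2 * (∑ k, ∑ l, pd j (fun y => ginv u y k l) x * d3 u i k l x)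
      + 1 / 4 * (∑ k, ∑ p, (∑ l, ginv u x k l * d3 u k p l x) * ∑ m, ginv u x p m * d3 u i j m x)
      - 1 / 4 * (∑ k, ∑ p, (∑ l, ginv u x k l * d3 u j p l x) *
          ∑ m, ginv u x p m * d3 u i k m x) := by
  have hswap : ∀ k l, d4 u k i j l x = d4 u j i k l x := by
    intro k l
    calc d4 u k i j l x = d4 u k j i l x :=
          pd_congr hN (fun _ hy => d3_swap_left hN hu hy i j l) hx k
      _ = d4 u j k i l x := pd_comm hN ((hu.pd hN l).pd hN i) hx k j
      _ = d4 u j i k l x := pd_congr hN (fun _ hy => d3_swap_left hN hu hy k i l) hx j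
  have h12 : (∑ k, pd k (Christoffel u k i j) x) - (∑ k, pd j (Christoffel u k i k) x)
      = 1 / 2 * (∑ k, ∑ l, pd k (fun y => ginv u y k l) x * d3 u i j l x)
        - 1 / 2 * (∑ k, ∑ l, pd j (fun y => ginv u y k l) x * d3 u i k l x) := by
    simp only [pd_christoffel hN hu hdet hx, Finset.mul_sum, ← Finset.sum_sub_distrib]
    refine Finset.sum_congr rfl fun k _ => Finset.sum_congr rfl fun l _ => ?_
    rw [hswap]
    ring
  have hΓ : ∀ a b c, Christoffel u a b c x = 1 / 2 * ∑ l, ginv u x a l * d3 u b c l x := by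
    intro a b c
    rw [christoffel_eq hN hu hx, Finset.mul_sum]
    exact Finset.sum_congr rfl fun l _ => mul_assoc _ _ _
  have hquad : ∀ a b : ℝ, 1 / 2 * a * (1 / 2 * b) = 1 / 4 * (a * b) := fun a b => by ring
  simp only [Ricci, h12, hΓ, hquad, ← Finset.mul_sum]

lemma ginv_symm (hN : IsOpen N) (hu : ContDiffOn ℝ (⊤ : ℕ∞) u N) (hx : x ∈ N) (a b : Fin n) :
    ginv u x a b = ginv u x b a := by
  have h : (hessian u x).IsSymm := Matrix.IsSymm.ext fun a b => pd_comm hN hu hx b a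
  have h' : (ginv u x).transpose = ginv u x := by
    rw [ginv, Matrix.transpose_nonsing_inv, h.eq]
  exact congrFun (congrFun h'.symm a) b

/-- The first derivative of the weighted Monge–Ampère equation. -/
lemma MAeq.sum_ginv_mul_d3 {v ξ : Fin n → ℝ} {c : ℝ} (hMA : MAeq u N v ξ c) (hN : IsOpen N)
    (hu : ContDiffOn ℝ (⊤ : ℕ∞) u N) (hdet : ∀ y ∈ N, (hessian u y).det ≠ 0) (hx : x ∈ N)
    (i : Fin n) :
    ∑ a, ∑ b, ginv u x b a * d3 u i a b x = -v i + ∑ q, hessian u x i q * ξ q := by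
  have hH : ∀ a b, ContDiffOn ℝ (⊤ : ℕ∞) (fun y => hessian u y a b) N :=
    fun a b => (hu.pd hN b).pd hN a
  have h1 := pd_log_det (fun a b => (hH a b).differentiableAt_of_isOpen hN hx) (hdet x hx) i
  have hd : ∀ q, DifferentiableAt ℝ (pd q u) x :=
    fun q => (hu.pd hN q).differentiableAt_of_isOpen hN hx
  have hsplit : pd i (fun y : Fin n → ℝ => -(∑ p, v p * y p) + (∑ q, pd q u y * ξ q) + c) x
      = pd i (fun y : Fin n → ℝ => ∑ q, pd q u y * ξ q) x
        - pd i (fun y : Fin n → ℝ => ∑ p, v p * y p) x := by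
    have hv : DifferentiableAt ℝ (fun y : Fin n → ℝ => ∑ p, v p * y p) x := by fun_prop
    have hξ : DifferentiableAt ℝ (fun y => ∑ q, pd q u y * ξ q) x := by fun_prop
    simp only [pd] at hξ ⊢
    rw [fderiv_add_const, fderiv_fun_add hv.fun_neg hξ, fderiv_fun_neg]
    simp only [_root_.add_apply, _root_.neg_apply]
    ring
  rw [pd_congr hN hMA hx i, hsplit,
    pd_sum_mul hd (fun q => differentiableAt_const _),
    pd_sum_mul (fun q => differentiableAt_const _) (fun q => by fun_prop)] at h1
  simp only [pd_const, pd_coord, mul_zero, add_zero, zero_mul, zero_add, Matrix.one_apply,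
    mul_ite, mul_one, Finset.sum_ite_eq, Finset.mem_univ, if_true] at h1
  rw [neg_add_eq_sub]
  exact h1.symm

end Hessian

lemma sum_comm_four (F : Fin n → Fin n → Fin n → Fin n → ℝ) :
    ∑ k, ∑ l, ∑ p, ∑ q, F k l p q = ∑ q, ∑ l, ∑ k, ∑ p, F k l p q := by
  calc ∑ k, ∑ l, ∑ p, ∑ q, F k l p q = ∑ k, ∑ q, ∑ l, ∑ p, F k l p q := by
        refine Finset.sum_congr rfl fun k _ => ?_
        rw [Finset.sum_comm (s := Finset.univ (α := Fin n)) (t := Finset.univ (α := Fin n))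
          (f := fun q l => ∑ p, F k l p q)]
        exact Finset.sum_congr rfl fun l _ => Finset.sum_comm
    _ = ∑ q, ∑ k, ∑ l, ∑ p, F k l p q := Finset.sum_comm
    _ = _ := Finset.sum_congr rfl fun q _ => Finset.sum_comm

theorem refined_ricci_formula {n : ℕ} (hn : 1 ≤ n) (N : Set (Fin n → ℝ)) (hNopen : IsOpen N)
    (hNne : N.Nonempty) (u : (Fin n → ℝ) → ℝ) (hu : ContDiffOn ℝ (⊤ : ℕ∞) u N)
    (hpos : ∀ x ∈ N, (hessian u x).PosDef)
    (v ξ : Fin n → ℝ) (c : ℝ) (hMA : MAeq u N v ξ c) :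
    ∀ x ∈ N, ∀ i j : Fin n,
      Ricci u i j x =
        (1/4) * (∑ p, ∑ q, ∑ m, ∑ m', ginv u x p q * ginv u x m m' *
          d3 u i p m x * d3 u j q m' x)
        - (1/4) * ((∑ p, d3 u i j p x * ξ p) - ∑ p, ∑ q, ginv u x p q * d3 u i j p x * v q) := by

  intro x hx i j
  have hdet : ∀ y ∈ N, (hessian u y).det ≠ 0 := fun y hy => (hpos y hy).det_pos.ne'
  have hH : ∀ a b, ContDiffOn ℝ (⊤ : ℕ∞) (fun y => hessian u y a b) N :=
    fun a b => (hu.pd hNopen b).pd hNopen a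
  have hdG : ∀ k a b, pd k (fun y => ginv u y a b) x
      = -∑ p, ∑ q, ginv u x a p * d3 u k p q x * ginv u x q b :=
    fun k a b => pd_inv hNopen hx hH hdet k a b
  have hG := ginv_symm hNopen hu hx
  have hL := d3_swap_left hNopen hu hx
  have hR := d3_swap_right hNopen hu hx
  have hMA' := hMA.sum_ginv_mul_d3 hNopen hu hdet hx
  set W := ∑ p, ∑ m, (∑ a, ∑ b, ginv u x b a * d3 u p a b x) * (ginv u x p m * d3 u i j m x)
    with hW
  set Q := ∑ p, ∑ q, ∑ m, ∑ m', ginv u x p q * ginv u x m m' * d3 u i p m x * d3 u j q m' x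
    with hQ
  have h1 : ∑ k, ∑ l, pd k (fun y => ginv u y k l) x * d3 u i j l x = -W := by
    simp only [hdG, hW, Finset.sum_mul, neg_mul, Finset.sum_neg_distrib, neg_inj]
    rw [sum_comm_four]
    refine Finset.sum_congr rfl fun q _ => Finset.sum_congr rfl fun l _ =>
      Finset.sum_congr rfl fun k _ => Finset.sum_congr rfl fun p _ => ?_
    rw [hR k p q, hL k q p, hG k p]
    ring
  have h2 : ∑ k, ∑ l, pd j (fun y => ginv u y k l) x * d3 u i k l x = -Q := by
    simp only [hdG, hQ, Finset.sum_mul, neg_mul, Finset.sum_neg_distrib, neg_inj]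
    refine Finset.sum_congr rfl fun k _ => ?_
    rw [Finset.sum_comm]
    refine Finset.sum_congr rfl fun p _ => Finset.sum_congr rfl fun l _ =>
      Finset.sum_congr rfl fun q _ => ?_
    rw [hG q l]
    ring
  have h3 : ∑ k, ∑ p, (∑ l, ginv u x k l * d3 u k p l x) * (∑ m, ginv u x p m * d3 u i j m x)
      = W := by
    simp only [hW, Finset.sum_mul_sum]
    simp only [Finset.sum_mul]
    rw [sum_comm_four, Finset.sum_comm]
    refine Finset.sum_congr rfl fun p _ => Finset.sum_congr rfl fun m _ =>
      Finset.sum_congr rfl fun k _ => Finset.sum_congr rfl fun l _ => ?_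
    rw [hL k p l, hG k l]
  have h4 : ∑ k, ∑ p, (∑ l, ginv u x k l * d3 u j p l x) * (∑ m, ginv u x p m * d3 u i k m x)
      = Q := by
    simp only [hQ, Finset.sum_mul_sum]
    refine Finset.sum_congr rfl fun k _ => ?_
    rw [Finset.sum_comm]
    refine Finset.sum_congr rfl fun l _ => ?_
    rw [Finset.sum_comm]
    refine Finset.sum_congr rfl fun m _ => Finset.sum_congr rfl fun p _ => ?_
    rw [hR j p l, hG p m]
    ring
  have hinv : ∀ m q, ∑ p, ginv u x m p * hessian u x p q
      = (1 : Matrix (Fin n) (Fin n) ℝ) m q := fun m q => by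
    rw [← Matrix.nonsing_inv_mul (hessian u x) (hdet x hx).isUnit]
    rfl
  have h5 : W = (∑ p, d3 u i j p x * ξ p) - ∑ p, ∑ q, ginv u x p q * d3 u i j p x * v q := by
    have hξ : ∀ m, d3 u i j m x * ξ m
        = ∑ p, (∑ q, hessian u x p q * ξ q) * (ginv u x p m * d3 u i j m x) := by
      intro m
      calc d3 u i j m x * ξ m
          = ∑ q, (∑ p, ginv u x m p * hessian u x p q) * (ξ q * d3 u i j m x) := by
            simp [hinv, Matrix.one_apply, mul_comm]
        _ = _ := by
            simp only [Finset.sum_mul]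
            rw [Finset.sum_comm]
            refine Finset.sum_congr rfl fun p _ => Finset.sum_congr rfl fun q _ => ?_
            rw [hG m p]
            ring
    simp only [hW, hMA', hξ, ← Finset.sum_sub_distrib]
    rw [Finset.sum_comm]
    refine Finset.sum_congr rfl fun m _ => Finset.sum_congr rfl fun p _ => ?_
    rw [hG m p]
    ring
  rw [ricci_eq hNopen hu hdet hx, h1, h2, h3, h4, ← h5]
  ring

end KRS
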